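/- arXiv:1912.06790 — 3 statements merged into one kernel-verified Lean document; each statement's English description precedes it below -/
import Mathlib

section
/- Modulation–angle relation for bilinear wave interactions: given a bilinear interaction (X₀, X₁, X₂) in ℝ^{1+2}, i.e. X₀ = X₁ + X₂ with X_j = (τ_j, ξ_j) and ξ_j ≠ 0, and signs (±₀, ±₁, ±₂), set h_j = τ_j ±_j |ξ_j| and θ₁₂ = |∠(±₁ξ₁, ±₂ξ₂)|. Then max(|h₀|, |h₁|, |h₂|) ≳ min(|ξ₁|, |ξ₂|) θ₁₂². -/
noncomputable section
open InnerProductGeometry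

/-- Physical space `ℝ²`. -/
abbrev Rd2 : Type := EuclideanSpace ℝ (Fin 2)

/-- The resonance function `s₀|x + y| - (s₁|x| + s₂|y|)` of the wave equation is bounded below in
terms of the angle between the signed frequencies. -/
theorem min_norm_mul_one_sub_cos_angle_le {E : Type*} [NormedAddCommGroup E]
    [InnerProductSpace ℝ E] {s0 s1 s2 : ℝ} (h0 : s0 = 1 ∨ s0 = -1) (h1 : s1 = 1 ∨ s1 = -1)
    (h2 : s2 = 1 ∨ s2 = -1) {x y : E} (hx : x ≠ 0) (hy : y ≠ 0) :
    min ‖x‖ ‖y‖ * (1 - Real.cos (angle (s1 • x) (s2 • y))) ≤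
      2 * |s0 * ‖x + y‖ - (s1 * ‖x‖ + s2 * ‖y‖)| := by
  have ha : 0 < ‖x‖ := norm_pos_iff.2 hx
  have hb : 0 < ‖y‖ := norm_pos_iff.2 hy
  have h0sq : s0 ^ 2 = 1 := sq_eq_one_iff.2 h0
  have h1abs : |s1| = 1 := by rcases h1 with rfl | rfl <;> simp
  have h2abs : |s2| = 1 := by rcases h2 with rfl | rfl <;> simp
  have h0abs : |s0| = 1 := by rcases h0 with rfl | rfl <;> simp
  have h12abs : |s1 * s2| = 1 := by rw [abs_mul, h1abs, h2abs, one_mul]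
  have h1sq : s1 ^ 2 = 1 := by rw [← sq_abs, h1abs, one_pow]
  have h2sq : s2 ^ 2 = 1 := by rw [← sq_abs, h2abs, one_pow]
  have hcos := cos_angle_mul_norm_mul_norm (s1 • x) (s2 • y)
  rw [real_inner_smul_left, real_inner_smul_right, norm_smul, norm_smul, Real.norm_eq_abs,
    Real.norm_eq_abs, h1abs, h2abs, one_mul, one_mul] at hcos
  have hle := Real.cos_le_one (angle (s1 • x) (s2 • y))
  have hadd := norm_add_sq_real x y
  have hc := norm_nonneg (x + y)
  have htri := norm_add_le x y
  generalize Real.cos (angle (s1 • x) (s2 • y)) = k at *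
  generalize ‖x + y‖ = c at *
  generalize ‖x‖ = a at *
  generalize ‖y‖ = b at *
  generalize inner ℝ x y = i at *
  have hi : i = s1 * s2 * (k * (a * b)) := by
    rw [hcos]
    linear_combination (-i) * h1sq - s1 ^ 2 * i * h2sq
  have hfactor : (s0 * c - (s1 * a + s2 * b)) * (s0 * c + (s1 * a + s2 * b)) =
      -(s1 * s2) * (2 * (a * b) * (1 - k)) := by
    linear_combination c ^ 2 * h0sq - a ^ 2 * h1sq - b ^ 2 * h2sq + hadd + 2 * hi
  have hprod : |s0 * c - (s1 * a + s2 * b)| * |s0 * c + (s1 * a + s2 * b)| =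
      2 * (a * b) * (1 - k) := by
    rw [← abs_mul, hfactor, abs_mul, abs_neg, h12abs, one_mul, abs_of_nonneg]
    have := sub_nonneg.2 hle
    positivity
  have hsum : |s0 * c + (s1 * a + s2 * b)| ≤ 2 * (a + b) := by
    calc |s0 * c + (s1 * a + s2 * b)| ≤ |s0 * c| + (|s1 * a| + |s2 * b|) :=
          (abs_add_le _ _).trans (by gcongr; exact abs_add_le _ _)
      _ = c + (a + b) := by
          rw [abs_mul, abs_mul, abs_mul, h0abs, h1abs, h2abs, abs_of_nonneg hc, abs_of_pos ha,
            abs_of_pos hb]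
          ring
      _ ≤ 2 * (a + b) := by linarith
  have hmin : min a b * (a + b) ≤ 2 * (a * b) := by
    rcases le_total a b with h | h
    · rw [min_eq_left h]; nlinarith
    · rw [min_eq_right h]; nlinarith
  refine le_of_mul_le_mul_right ?_ (add_pos ha hb)
  calc min a b * (1 - k) * (a + b) = min a b * (a + b) * (1 - k) := by ring
    _ ≤ 2 * (a * b) * (1 - k) := mul_le_mul_of_nonneg_right hmin (sub_nonneg.2 hle)
    _ ≤ |s0 * c - (s1 * a + s2 * b)| * (2 * (a + b)) :=
        hprod ▸ mul_le_mul_of_nonneg_left hsum (abs_nonneg _)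
    _ = 2 * |s0 * c - (s1 * a + s2 * b)| * (a + b) := by ring

/-- **Modulation–angle relation for bilinear wave interactions.** For a bilinear
interaction `X₀ = X₁ + X₂` in `ℝ^{1+2}` with `ξ₁, ξ₂ ≠ 0` and signs `±₀, ±₁, ±₂`,
setting `h_j = τ_j ±_j |ξ_j|` and `θ₁₂ = ∠(±₁ξ₁, ±₂ξ₂)`, one has
`max(|h₀|,|h₁|,|h₂|) ≳ min(|ξ₁|,|ξ₂|) θ₁₂²` with an absolute constant. -/
theorem modulation_angle_relation :
    ∃ C : ℝ, 0 < C ∧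
      ∀ (s0 s1 s2 : ℝ), (s0 = 1 ∨ s0 = -1) → (s1 = 1 ∨ s1 = -1) → (s2 = 1 ∨ s2 = -1) →
      ∀ (τ0 τ1 τ2 : ℝ) (ξ0 ξ1 ξ2 : Rd2), ξ1 ≠ 0 → ξ2 ≠ 0 →
        τ0 = τ1 + τ2 → ξ0 = ξ1 + ξ2 →
        C * (min ‖ξ1‖ ‖ξ2‖ * (angle (s1 • ξ1) (s2 • ξ2)) ^ 2) ≤
          max (|τ0 + s0 * ‖ξ0‖|) (max (|τ1 + s1 * ‖ξ1‖|) (|τ2 + s2 * ‖ξ2‖|)) := by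
  refine ⟨1 / (3 * Real.pi ^ 2), by positivity, ?_⟩
  rintro s0 s1 s2 h0 h1 h2 τ0 τ1 τ2 ξ0 ξ1 ξ2 hξ1 hξ2 rfl rfl
  have hres := min_norm_mul_one_sub_cos_angle_le h0 h1 h2 hξ1 hξ2
  have hcos := Real.cos_le_one_sub_mul_cos_sq (x := angle (s1 • ξ1) (s2 • ξ2))
    (by rw [abs_of_nonneg (angle_nonneg _ _)]; exact angle_le_pi _ _)
  generalize angle (s1 • ξ1) (s2 • ξ2) = θ at *
  have hquad : min ‖ξ1‖ ‖ξ2‖ * (2 / Real.pi ^ 2 * θ ^ 2) ≤ min ‖ξ1‖ ‖ξ2‖ * (1 - Real.cos θ) := by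
    gcongr
    linarith
  have hmod : |s0 * ‖ξ1 + ξ2‖ - (s1 * ‖ξ1‖ + s2 * ‖ξ2‖)| ≤
      3 * max |τ1 + τ2 + s0 * ‖ξ1 + ξ2‖| (max |τ1 + s1 * ‖ξ1‖| |τ2 + s2 * ‖ξ2‖|) := by
    set M := max |τ1 + τ2 + s0 * ‖ξ1 + ξ2‖| (max |τ1 + s1 * ‖ξ1‖| |τ2 + s2 * ‖ξ2‖|) with hM
    have hm0 := abs_le.1 (le_max_left _ _ |>.trans_eq hM.symm)
    have hm1 := abs_le.1 ((le_max_left _ _).trans (le_max_right _ _) |>.trans_eq hM.symm)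
    have hm2 := abs_le.1 ((le_max_right _ _).trans (le_max_right _ _) |>.trans_eq hM.symm)
    rw [abs_le]
    constructor <;> linarith
  have hconst : 1 / (3 * Real.pi ^ 2) * (min ‖ξ1‖ ‖ξ2‖ * θ ^ 2) =
      min ‖ξ1‖ ‖ξ2‖ * (2 / Real.pi ^ 2 * θ ^ 2) / 6 := by
    field_simp
    ring
  rw [hconst]
  linarith

end
end

section
/- Interpolated angle bound: given a bilinear interaction X₀ = X₁ + X₂ in ℝ^{1+2} with ξ_j ≠ 0 and signs (±₀,±₁,±₂), set h_j = τ_j ±_j |ξ_j| and θ₁₂ = |∠(±₁ξ₁,±₂ξ₂)|. Then for every p with 0 ≤ p ≤ 1/2, θ₁₂ ≲ ( max(|h₀|,|h₁|,|h₂|) / min(|ξ₁|,|ξ₂|) )^p. -/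
noncomputable section
open InnerProductGeometry

/-- Defect in the triangle inequality `N ≤ a + b`, for the third side of a triangle. -/
lemma third_side_le {a b c m N : ℝ} (hm : 0 ≤ m) (hma : m ≤ a) (hmb : m ≤ b)
    (hc : -1 ≤ c) (hc1 : c ≤ 1) (hN : N ^ 2 = a ^ 2 + b ^ 2 + 2 * (a * b * c)) :
    N ≤ a + b - m * (1 - c) / 2 := by
  have hK : 0 ≤ a + b - m * (1 - c) / 2 := by nlinarith
  refine (abs_le_of_sq_le_sq' ?_ hK).2
  have h1 : (a + b) * m ≤ 2 * (a * b) := by nlinarith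
  have h2 := mul_le_mul_of_nonneg_right h1 (sub_nonneg.2 hc1)
  nlinarith [sq_nonneg (m * (1 - c))]

/-- Defect in the reverse triangle inequality `a - b ≤ N`, for the third side of a triangle. -/
lemma le_third_side {a b c m N : ℝ} (hm : 0 ≤ m) (hma : m ≤ a) (hmb : m ≤ b)
    (hc : -1 ≤ c) (hc1 : c ≤ 1) (hN0 : 0 ≤ N)
    (hN : N ^ 2 = a ^ 2 + b ^ 2 - 2 * (a * b * c)) :
    a - b + m * (1 - c) / 2 ≤ N := by
  rcases le_or_gt (a - b + m * (1 - c) / 2) 0 with h | h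
  · exact h.trans hN0
  refine (abs_le_of_sq_le_sq' ?_ hN0).2
  have h1 : (a - b) * m + m * m * (1 - c) / 4 ≤ 2 * (a * b) := by
    nlinarith [mul_nonneg hm hm, mul_nonneg (mul_nonneg hm hm) (by linarith : 0 ≤ 1 + c),
      mul_nonneg (sub_nonneg.2 hma) (sub_nonneg.2 hmb), mul_nonneg hm (sub_nonneg.2 hma),
      mul_nonneg hm (sub_nonneg.2 hmb)]
  have h2 := mul_le_mul_of_nonneg_right h1 (sub_nonneg.2 hc1)
  nlinarith

/-- The modulation bound with quadratic angular gain, in terms of `1 - cos θ₁₂`. -/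
lemma min_norm_mul_one_sub_cos_le {s0 s1 s2 : ℝ} (h0 : s0 = 1 ∨ s0 = -1)
    (h1 : s1 = 1 ∨ s1 = -1) (h2 : s2 = 1 ∨ s2 = -1) (x y : Rd2) :
    min ‖x‖ ‖y‖ * (1 - Real.cos (angle (s1 • x) (s2 • y))) / 2 ≤
      |s0 * ‖x + y‖ - s1 * ‖x‖ - s2 * ‖y‖| := by
  have hm : 0 ≤ min ‖x‖ ‖y‖ := le_min (norm_nonneg _) (norm_nonneg _)
  have hin := cos_angle_mul_norm_mul_norm (s1 • x) (s2 • y)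
  have hN := norm_add_sq_real x y
  have hc := Real.neg_one_le_cos (angle (s1 • x) (s2 • y))
  have hc1 := Real.cos_le_one (angle (s1 • x) (s2 • y))
  have hn1 : ‖s1 • x‖ = ‖x‖ := by rcases h1 with rfl | rfl <;> simp
  have hn2 : ‖s2 • y‖ = ‖y‖ := by rcases h2 with rfl | rfl <;> simp
  rw [hn1, hn2, real_inner_smul_left, real_inner_smul_right] at hin
  generalize Real.cos (angle (s1 • x) (s2 • y)) = c at *
  have hma := min_le_left ‖x‖ ‖y‖
  have hmb := min_le_right ‖x‖ ‖y‖
  generalize min ‖x‖ ‖y‖ = m at *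
  have hN0 := norm_nonneg (x + y)
  have key1 := third_side_le (N := ‖x + y‖) hm hma hmb hc hc1
  have key2 := le_third_side (N := ‖x + y‖) hm hma hmb hc hc1 hN0
  have key3 := le_third_side (N := ‖x + y‖) hm hmb hma hc hc1 hN0
  have hx := norm_nonneg x
  have hy := norm_nonneg y
  rw [le_abs]
  rcases h1 with rfl | rfl <;> rcases h2 with rfl | rfl
  · have := key1 (by linarith)
    right; rcases h0 with rfl | rfl <;> linarith
  · have k2 := key2 (by linarith)
    have k3 := key3 (by linarith)
    rcases h0 with rfl | rfl
    · left; linarith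
    · right; linarith
  · have k2 := key2 (by linarith)
    have k3 := key3 (by linarith)
    rcases h0 with rfl | rfl
    · left; linarith
    · right; linarith
  · have := key1 (by linarith)
    left; rcases h0 with rfl | rfl <;> linarith

/-- Interpolation of a square-root bound with a trivial bound. -/
lemma le_mul_rpow_of_sq_le {θ C r p : ℝ} (hC : 0 ≤ C) (hr : 0 ≤ r) (hθ : θ ≤ C)
    (h : θ ^ 2 ≤ C ^ 2 * r) (hp0 : 0 ≤ p) (hp : p ≤ 1 / 2) : θ ≤ C * r ^ p := by
  rcases le_total 1 r with h1 | h1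
  · exact hθ.trans (le_mul_of_one_le_right hC (Real.one_le_rpow h1 hp0))
  · rcases hr.eq_or_lt with rfl | hr
    · have : θ = 0 := by nlinarith [sq_nonneg θ]
      rw [this]
      positivity
    · have hs : θ ≤ C * √r := by
        refine (abs_le_of_sq_le_sq' ?_ (by positivity)).2
        rwa [mul_pow, Real.sq_sqrt hr.le]
      rw [Real.sqrt_eq_rpow] at hs
      exact hs.trans (mul_le_mul_of_nonneg_left
        (Real.rpow_le_rpow_of_exponent_ge hr h1 hp) hC)

/-- **Interpolated angle bound.** For a bilinear interaction `X₀ = X₁ + X₂` in `ℝ^{1+2}`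
with `ξ₁, ξ₂ ≠ 0` and signs `±₀, ±₁, ±₂`, setting `h_j = τ_j ±_j |ξ_j|` and
`θ₁₂ = ∠(±₁ξ₁, ±₂ξ₂)`, for every `0 ≤ p ≤ 1/2` one has
`θ₁₂ ≲ (max(|h₀|,|h₁|,|h₂|) / min(|ξ₁|,|ξ₂|))^p` with an absolute constant. -/
theorem interpolated_angle_bound :
    ∃ C : ℝ, 0 < C ∧
      ∀ (s0 s1 s2 : ℝ), (s0 = 1 ∨ s0 = -1) → (s1 = 1 ∨ s1 = -1) → (s2 = 1 ∨ s2 = -1) →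
      ∀ (τ0 τ1 τ2 : ℝ) (ξ0 ξ1 ξ2 : Rd2), ξ1 ≠ 0 → ξ2 ≠ 0 →
        τ0 = τ1 + τ2 → ξ0 = ξ1 + ξ2 →
        ∀ p : ℝ, 0 ≤ p → p ≤ 1/2 →
        angle (s1 • ξ1) (s2 • ξ2) ≤
          C * (max (|τ0 + s0 * ‖ξ0‖|) (max (|τ1 + s1 * ‖ξ1‖|) (|τ2 + s2 * ‖ξ2‖|)) /
                min ‖ξ1‖ ‖ξ2‖) ^ p := by
  refine ⟨2 * Real.pi, by positivity, ?_⟩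
  intro s0 s1 s2 h0 h1 h2 τ0 τ1 τ2 ξ0 ξ1 ξ2 hξ1 hξ2 hτ hξ p hp0 hp
  subst hτ hξ
  have hpi := Real.pi_pos
  have hθ0 := angle_nonneg (s1 • ξ1) (s2 • ξ2)
  have hθ := angle_le_pi (s1 • ξ1) (s2 • ξ2)
  have hcos := Real.cos_le_one_sub_mul_cos_sq (abs_le.2 ⟨by linarith, hθ⟩)
  have hm : 0 < min ‖ξ1‖ ‖ξ2‖ := lt_min (norm_pos_iff.2 hξ1) (norm_pos_iff.2 hξ2)
  have key := min_norm_mul_one_sub_cos_le h0 h1 h2 ξ1 ξ2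
  set M := max (|τ1 + τ2 + s0 * ‖ξ1 + ξ2‖|) (max (|τ1 + s1 * ‖ξ1‖|) (|τ2 + s2 * ‖ξ2‖|))
  have hM0 : |τ1 + τ2 + s0 * ‖ξ1 + ξ2‖| ≤ M := le_max_left _ _
  have hM1 : |τ1 + s1 * ‖ξ1‖| ≤ M := (le_max_left _ _).trans (le_max_right _ _)
  have hM2 : |τ2 + s2 * ‖ξ2‖| ≤ M := (le_max_right _ _).trans (le_max_right _ _)
  have hMnonneg : 0 ≤ M := (abs_nonneg _).trans hM0
  have h3M : |s0 * ‖ξ1 + ξ2‖ - s1 * ‖ξ1‖ - s2 * ‖ξ2‖| ≤ 3 * M := by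
    rw [abs_le] at *
    constructor <;> linarith [hM0.1, hM0.2, hM1.1, hM1.2, hM2.1, hM2.2]
  refine le_mul_rpow_of_sq_le (by positivity) (by positivity) (by linarith) ?_ hp0 hp
  generalize angle (s1 • ξ1) (s2 • ξ2) = θ at *
  generalize min ‖ξ1‖ ‖ξ2‖ = m at *
  have hquad : m * (2 / Real.pi ^ 2 * θ ^ 2) ≤ m * (1 - Real.cos θ) :=
    mul_le_mul_of_nonneg_left (by linarith) hm.le
  have hfin : m * (2 / Real.pi ^ 2 * θ ^ 2) ≤ 6 * M := by linarith
  have heq : m * (2 / Real.pi ^ 2 * θ ^ 2) = 2 * (θ ^ 2 * m) / Real.pi ^ 2 := by ring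
  rw [heq, div_le_iff₀ (by positivity)] at hfin
  rw [← mul_div_assoc, le_div_iff₀ hm]
  nlinarith [mul_nonneg hMnonneg (sq_nonneg Real.pi)]

end
end

section
/- Failure of the quadratic estimate for the second derivative of the gauge potential flow: let s < 0 and T > 0. Then there is no constant C such that sup_{0≤t≤T} ‖(F₀, F₁, F₂)(t)‖_{H^s} ≤ C‖ψ₀‖²_{H^s} holds for all ψ₀ ∈ H^s(ℝ²;ℂ²), where F_ν(t) = Σ over sign choices ±₁,±₂,±₃ of ∫₀ᵗ U_{±₁}(t−t') [ R^μ_{±₁}( ε_{μνλ} (U_{±₂}(t')ψ₀)† α^λ U_{±₃}(t')ψ₀ ) ] dt' (summation over μ, λ ∈ {0,1,2}). -/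
noncomputable section
open MeasureTheory Complex InnerProductGeometry
open scoped ENNReal FourierTransform

/-- Space-time `ℝ^{1+2}`, coordinates `X 0 = τ (or t)`, `(X 1, X 2) = ξ (or x)`. -/
abbrev Rst : Type := EuclideanSpace ℝ (Fin 3)
/-- Spinor space `ℂ²`. -/
abbrev Spinor : Type := EuclideanSpace ℂ (Fin 2)

/-- Pauli matrix σ¹. -/
def sigma1 : Matrix (Fin 2) (Fin 2) ℂ := !![0, 1; 1, 0]
/-- Pauli matrix σ². -/
def sigma2 : Matrix (Fin 2) (Fin 2) ℂ := !![0, -Complex.I; Complex.I, 0]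
/-- Pauli matrix σ³. -/
def sigma3 : Matrix (Fin 2) (Fin 2) ℂ := !![1, 0; 0, -1]
/-- Dirac matrices `α⁰ = I, α¹ = σ¹, α² = σ²`. -/
def alphaM : Fin 3 → Matrix (Fin 2) (Fin 2) ℂ := ![1, sigma1, sigma2]

/-- A 2×2 complex matrix acting on a spinor. -/
def mulVecE (M : Matrix (Fin 2) (Fin 2) ℂ) (v : Spinor) : Spinor :=
  (EuclideanSpace.equiv (Fin 2) ℂ).symm (fun i => ∑ j, M i j * v j)

/-- `v† w` for spinors. -/
def pairD (v w : Spinor) : ℂ := ∑ i, (starRingEnd ℂ) (v i) * w i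

/-- The totally skew-symmetric tensor with `ε₀₁₂ = 1`. -/
def eps (a b c : Fin 3) : ℝ :=
  ((b.val : ℝ) - (a.val : ℝ)) * ((c.val : ℝ) - (b.val : ℝ)) * ((c.val : ℝ) - (a.val : ℝ)) / 2

/-- value of a sign represented by a Bool: `true ↦ +1`, `false ↦ -1`. -/
def sv (b : Bool) : ℝ := if b then 1 else -1

/-- Dyadic Littlewood–Paley condition: the `k`-th dyadic block (`N = 2^k`); the lowest
block `k = 0` captures `{|ξ| < 2}`. -/
def LPcond (k : ℕ) (r : ℝ) : Prop := if k = 0 then r < 2 else (2:ℝ)^k ≤ r ∧ r < 2^(k+1)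

/-- The `k`-th Littlewood–Paley frequency annulus in `ℝ²`. -/
def LPset (k : ℕ) : Set Rd2 := {ξ | LPcond k ‖ξ‖}

/-- `‖P_N f‖_{L²}` for `N = 2^k`, computed on the Fourier side (Plancherel). -/
def LPnorm {E : Type*} [NormedAddCommGroup E] [NormedSpace ℂ E] (k : ℕ) (f : Rd2 → E) : ℝ≥0∞ :=
  eLpNorm ((LPset k).indicator (𝓕 f)) 2 volume

/-- Sobolev `H^s` norm, `‖f‖_{H^s} = (Σ_{dyadic N ≥ 1} N^{2s} ‖P_N f‖²_{L²})^{1/2}`. -/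
def sobNorm {E : Type*} [NormedAddCommGroup E] [NormedSpace ℂ E] (s : ℝ) (f : Rd2 → E) : ℝ≥0∞ :=
  (∑' k : ℕ, (2:ℝ≥0∞) ^ (2 * s * (k:ℝ)) * (LPnorm k f)^2) ^ (1/2 : ℝ)

/-- Besov `B^s_{2,1}` norm, `‖f‖ = Σ_{dyadic N ≥ 1} N^s ‖P_N f‖_{L²}`. -/
def besovNorm {E : Type*} [NormedAddCommGroup E] [NormedSpace ℂ E] (s : ℝ) (f : Rd2 → E) : ℝ≥0∞ :=
  ∑' k : ℕ, (2:ℝ≥0∞) ^ (s * (k:ℝ)) * LPnorm k f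

/-- Fourier multiplier on `ℝ²` with symbol `m`. -/
def fmul {E : Type*} [NormedAddCommGroup E] [NormedSpace ℂ E] (m : Rd2 → ℂ) (f : Rd2 → E) :
    Rd2 → E := 𝓕⁻ (fun ξ => m ξ • 𝓕 f ξ)

/-- Half-wave propagator `U_±(t) = e^{∓itD}` (`sg = ±1`), `D = |∇|` the multiplier with
symbol `|ξ|`. -/
def Uop {E : Type*} [NormedAddCommGroup E] [NormedSpace ℂ E] (sg t : ℝ) (f : Rd2 → E) :
    Rd2 → E := fmul (fun ξ => Complex.exp (-Complex.I * ((sg * t * ‖ξ‖ : ℝ) : ℂ))) f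

/-- spatial index of a nonzero space-time index. -/
def sIdx (j : Fin 3) : Fin 2 := if j = 1 then 0 else 1

/-- Symbols of the modified Riesz transforms: `r⁰_± = -1`, `r^j_± = ∓ξ_j/|ξ|`. -/
def rsym (sg : ℝ) (μ : Fin 3) (ξ : Rd2) : ℂ :=
  if μ = 0 then -1 else ((-(sg * ξ (sIdx μ)) / ‖ξ‖ : ℝ) : ℂ)

/-- Modified Riesz transform `R^μ_±` as a Fourier multiplier on `ℝ²`. -/
def riesz {E : Type*} [NormedAddCommGroup E] [NormedSpace ℂ E] (sg : ℝ) (μ : Fin 3)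
    (f : Rd2 → E) : Rd2 → E := fmul (rsym sg μ) f

/-- Symbol of the Dirac projection `Π_±(ξ) = (1/2)(I ± ξ_jα^j/|ξ|)`. -/
def PiSym (sg : ℝ) (ξ : Rd2) : Matrix (Fin 2) (Fin 2) ℂ :=
  (1/2 : ℂ) • (1 + ((sg / ‖ξ‖ : ℝ) : ℂ) • (((ξ 0 : ℝ) : ℂ) • sigma1 + ((ξ 1 : ℝ) : ℂ) • sigma2))

/-- Dirac projection `Π_±` acting as a Fourier multiplier on spinor fields over `ℝ²`. -/
def PiOp (sg : ℝ) (ψ : Rd2 → Spinor) : Rd2 → Spinor :=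
  𝓕⁻ (fun ξ => mulVecE (PiSym sg ξ) (𝓕 ψ ξ))
/-- The bilinear current `ε_{μνλ} (U_{±₂}(t')ψ₀)† α^λ U_{±₃}(t')ψ₀`. -/
def Fcurr (s2 s3 : Bool) (ψ0 : Rd2 → Spinor) (μ ν : Fin 3) (t' : ℝ) : Rd2 → ℂ := fun x =>
  ∑ lam : Fin 3, ((eps μ ν lam : ℝ) : ℂ) *
    pairD (Uop (sv s2) t' ψ0 x) (mulVecE (alphaM lam) (Uop (sv s3) t' ψ0 x))

/-- The second derivative of the gauge potential flow at the origin: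
`F_ν(t) = Σ_{±₁,±₂,±₃} ∫₀ᵗ U_{±₁}(t−t')[R^μ_{±₁}(ε_{μνλ}(U_{±₂}(t')ψ₀)†α^λU_{±₃}(t')ψ₀)]dt'`. -/
def Fnu (ψ0 : Rd2 → Spinor) (ν : Fin 3) (t : ℝ) : Rd2 → ℂ := fun x =>
  ∑ s1 : Bool, ∑ s2 : Bool, ∑ s3 : Bool, ∫ t' in (0:ℝ)..t,
    Uop (sv s1) (t - t')
      (fun y => ∑ μ : Fin 3, riesz (sv s1) μ (Fcurr s2 s3 ψ0 μ ν t') y) x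

open scoped ContDiff Convolution

/-- Smooth compactly supported functions on `ℝ²`. -/
def IsTest {E : Type*} [NormedAddCommGroup E] [NormedSpace ℝ E] (f : Rd2 → E) : Prop :=
  ContDiff ℝ ∞ f ∧ HasCompactSupport f

section IsTest

variable {E : Type*} [NormedAddCommGroup E] [NormedSpace ℂ E]

lemma IsTest.integrable {f : Rd2 → E} (hf : IsTest f) : Integrable f :=
  hf.1.continuous.integrable_of_hasCompactSupport hf.2

lemma IsTest.add {f g : Rd2 → E} (hf : IsTest f) (hg : IsTest g) :
    IsTest (fun x => f x + g x) :=
  ⟨hf.1.add hg.1, hf.2.add hg.2⟩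

lemma IsTest.smooth_mul {m f : Rd2 → ℂ} (hm : ContDiff ℝ ∞ m) (hf : IsTest f) :
    IsTest (fun x => m x * f x) :=
  ⟨hm.mul hf.1, hf.2.mul_left⟩

lemma isTest_sum {ι : Type*} (s : Finset ι) {f : ι → Rd2 → ℂ} (hf : ∀ i, IsTest (f i)) :
    IsTest (fun x => ∑ i ∈ s, f i x) := by
  classical
  induction s using Finset.induction_on with
  | empty =>
    exact ⟨by simpa using contDiff_const, by
      simpa using HasCompactSupport.of_support_subset_isCompact isCompact_empty
        (f := fun _ : Rd2 => (0 : ℂ)) (by simp)⟩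
  | insert a s ha ih => simpa [Finset.sum_insert ha] using (hf a).add ih

variable [CompleteSpace E]

lemma IsTest.fourier_fourierInv {f : Rd2 → E} (hf : IsTest f) : 𝓕 (𝓕⁻ f) = f := by
  have h : 𝓕 (𝓕⁻ (hf.2.toSchwartzMap hf.1)) = hf.2.toSchwartzMap hf.1 :=
    FourierTransform.fourier_fourierInv_eq _
  have h2 := congrArg (fun g : SchwartzMap Rd2 E => (g : Rd2 → E)) h
  rwa [SchwartzMap.fourier_coe, SchwartzMap.fourierInv_coe] at h2

lemma IsTest.fmul_fourierInv {f : Rd2 → E} (hf : IsTest f) (m : Rd2 → ℂ) :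
    fmul m (𝓕⁻ f) = 𝓕⁻ (fun ξ => m ξ • f ξ) := by
  rw [fmul, hf.fourier_fourierInv]

end IsTest

lemma integrable_fourierInv_integrand {E : Type*} [NormedAddCommGroup E] [NormedSpace ℂ E]
    {f : Rd2 → E} (hf : Integrable f) (x : Rd2) :
    Integrable (fun v => Real.fourierChar (inner ℝ v x) • f v) := by
  simpa using (Real.fourierIntegral_convergent_iff (-x)).2 hf

lemma fourierInv_sum_apply {ι : Type*} (s : Finset ι) {f : ι → Rd2 → ℂ}
    (hf : ∀ i, Integrable (f i)) (x : Rd2) :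
    𝓕⁻ (fun ξ => ∑ i ∈ s, f i ξ) x = ∑ i ∈ s, 𝓕⁻ (f i) x := by
  simp only [Real.fourierInv_eq, Finset.smul_sum]
  exact integral_finsetSum _ fun i _ => integrable_fourierInv_integrand (hf i) x

lemma fourierInv_linear_comb {f g : Rd2 → ℂ} (hf : Integrable f) (hg : Integrable g)
    (c d : ℂ) (x : Rd2) :
    𝓕⁻ (fun ξ => c * f ξ + d * g ξ) x = c * 𝓕⁻ f x + d * 𝓕⁻ g x := by
  simp only [Real.fourierInv_eq, smul_add, ← integral_const_mul, mul_smul_comm]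
  rw [integral_add]
  · simpa using (integrable_fourierInv_integrand (hf.const_mul c) x)
  · simpa using (integrable_fourierInv_integrand (hg.const_mul d) x)

lemma fourierInv_apply_coord {h : Rd2 → Spinor} (hh : Integrable h) (x : Rd2) (i : Fin 2) :
    𝓕⁻ h x i = 𝓕⁻ (fun ξ => h ξ i) x := by
  simp only [Real.fourierInv_eq]
  exact ((EuclideanSpace.proj (𝕜 := ℂ) i : Spinor →L[ℂ] ℂ).integral_comp_comm
    (integrable_fourierInv_integrand hh x)).symm

/-- Cross-correlation of two functions on `ℝ²`. -/
def corr (a b : Rd2 → ℂ) (ξ : Rd2) : ℂ := ∫ η, (starRingEnd ℂ) (a η) * b (η + ξ)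

lemma contDiff_integral_of_compact_support {P G : Type*} [NormedAddCommGroup P] [NormedSpace ℝ P]
    [NormedAddCommGroup G] [NormedSpace ℝ G] [MeasurableSpace G] [BorelSpace G]
    (μ : Measure G) [IsLocallyFiniteMeasure μ]  {Φ : P → G → ℂ} {k : Set G} (hk : IsCompact k)
    (h0 : ∀ p, ∀ x, x ∉ k → Φ p x = 0) (hΦ : ContDiff ℝ ∞ (fun q : P × G => Φ q.1 q.2)) :
    ContDiff ℝ ∞ (fun p => ∫ x, Φ p x ∂μ) := by
  have hc := contDiffOn_convolution_right_with_param (μ := μ) (f := fun _ : G => (1 : ℝ))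
    (n := ⊤) (ContinuousLinearMap.lsmul ℝ ℝ) (g := fun p x => Φ p (-x)) (s := Set.univ) (k := -k)
    isOpen_univ hk.neg (fun p x _ hx => h0 p _ (by simpa using hx)) (locallyIntegrable_const 1)
    (by
      have : ContDiff ℝ ∞ (fun q : P × G => Φ q.1 (-q.2)) :=
        hΦ.comp (contDiff_fst.prodMk contDiff_snd.neg)
      exact this.contDiffOn)
  have h1 : ContDiff ℝ ∞ (fun q : P × G =>
      (convolution (fun _ : G => (1 : ℝ)) ((fun p x => Φ p (-x)) q.1)
        (ContinuousLinearMap.lsmul ℝ ℝ) μ) q.2) := by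
    rw [← contDiffOn_univ, ← Set.univ_prod_univ]; exact hc
  have h2 := h1.comp (contDiff_id.prodMk (contDiff_const (c := (0 : G))))
  simpa [convolution, Function.comp_def] using h2

section Corr

variable {a b : Rd2 → ℂ}

lemma corr_eq_zero {ξ : Rd2} (h : ∀ η, a η = 0 ∨ b (η + ξ) = 0) : corr a b ξ = 0 := by
  rw [corr, ← integral_zero Rd2 ℂ]
  congr 1
  ext η
  rcases h η with h | h <;> simp [h]

lemma corr_eq_convolution (a b : Rd2 → ℂ) :
    corr a b = (fun η => (starRingEnd ℂ) (a (-η))) ⋆[ContinuousLinearMap.mul ℂ ℂ] b := by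
  ext ξ
  rw [corr, convolution, ← integral_neg_eq_self]
  simp [sub_eq_neg_add]

lemma IsTest.conj_neg (ha : IsTest a) : IsTest (fun η => (starRingEnd ℂ) (a (-η))) := by
  refine ⟨Complex.conjCLE.contDiff.comp (ha.1.comp contDiff_neg), ?_⟩
  exact (ha.2.comp_homeomorph (Homeomorph.neg Rd2)).comp_left (map_zero (starRingEnd ℂ))

lemma IsTest.corr (ha : IsTest a) (hb : IsTest b) : IsTest (corr a b) := by
  constructor
  · refine contDiff_integral_of_compact_support volume (k := tsupport a) ha.2
      (fun ξ η hη => by simp [image_eq_zero_of_notMem_tsupport hη]) ?_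
    exact (Complex.conjCLE.contDiff.comp (ha.1.comp contDiff_snd)).mul
      (hb.1.comp (contDiff_snd.add contDiff_fst))
  · rw [corr_eq_convolution]
    exact ha.conj_neg.2.convolution _ hb.2

lemma fourierInv_corr (ha : IsTest a) (hb : IsTest b) (x : Rd2) :
    𝓕⁻ (_root_.corr a b) x = (starRingEnd ℂ) (𝓕⁻ a x) * 𝓕⁻ b x := by
  rw [corr_eq_convolution, Real.fourierInv_eq_fourier_neg,
    Real.fourier_mul_convolution_eq ha.conj_neg.integrable hb.integrable,
    ← Real.fourierInv_eq_fourier_neg b, Real.fourier_eq, Real.fourierInv_eq a, ← integral_conj,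
    ← integral_neg_eq_self]
  congr 1
  refine integral_congr_ae (.of_forall fun v => ?_)
  simp [Circle.smul_def, ← Circle.coe_inv_eq_conj, ← AddChar.map_neg_eq_inv]

end Corr

/-- A bump function near the origin of frequency space. -/
def lowBump : ContDiffBump (0 : Rd2) := ⟨1 / 4, 1 / 2, by norm_num, by norm_num⟩

/-- A smooth positive function equal to `‖ξ‖` for `‖ξ‖ ≥ 1/2`. -/
def omega (ξ : Rd2) : ℝ := √(‖ξ‖ ^ 2 + lowBump ξ)

lemma omega_pos (ξ : Rd2) : 0 < omega ξ := by
  refine Real.sqrt_pos.2 ?_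
  by_cases h : ξ = 0
  · have : lowBump (0 : Rd2) = 1 := lowBump.one_of_mem_closedBall (by simp [lowBump])
    simp [h, this]
  · have := lowBump.nonneg (x := ξ)
    positivity

lemma omega_eq {ξ : Rd2} (h : 1 / 2 ≤ ‖ξ‖) : omega ξ = ‖ξ‖ := by
  have : lowBump ξ = 0 := lowBump.zero_of_le_dist (by simpa [lowBump] using h)
  simp [omega, this]

lemma contDiff_omega : ContDiff ℝ ∞ omega := by
  refine ContDiff.sqrt ((contDiff_norm_sq ℝ).add lowBump.contDiff) fun ξ => ?_
  exact (Real.sqrt_pos.1 (omega_pos ξ)).ne'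

/-- The profile of the wave packets in frequency space. -/
def bump : ContDiffBump (0 : Rd2) := ⟨1 / 16, 1 / 8, by norm_num, by norm_num⟩

/-- A wave packet (in frequency space) centred at `p`. -/
def packet (p ξ : Rd2) : ℂ := (bump (ξ - p) : ℂ)

lemma packet_eq_zero {p ξ : Rd2} (h : 1 / 8 ≤ ‖ξ - p‖) : packet p ξ = 0 := by
  have : bump (ξ - p) = 0 := bump.zero_of_le_dist (by simpa [bump] using h)
  simp [packet, this]

lemma contDiff_packet (p : Rd2) : ContDiff ℝ ∞ (packet p) :=
  Complex.ofRealCLM.contDiff.comp (bump.contDiff.comp (contDiff_id.sub contDiff_const))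

lemma packet_eq_zero_of_notMem {p ξ : Rd2} (h : ξ ∉ Metric.closedBall p (1 / 8)) :
    packet p ξ = 0 :=
  packet_eq_zero (by rw [← dist_eq_norm]; exact (not_le.1 (mt Metric.mem_closedBall.2 h)).le)

lemma isTest_packet (p : Rd2) : IsTest (packet p) :=
  ⟨contDiff_packet p, HasCompactSupport.intro (isCompact_closedBall p (1 / 8))
    fun _ h => packet_eq_zero_of_notMem h⟩

/-- The half-wave phase, smoothed out at low frequencies. -/
def phase (s t : ℝ) (ξ : Rd2) : ℂ := Complex.exp (-Complex.I * ((s * t * omega ξ : ℝ) : ℂ))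

lemma contDiff_phase_prod (s : ℝ) : ContDiff ℝ ∞ (fun q : ℝ × Rd2 => phase s q.1 q.2) :=
  (contDiff_const.mul (Complex.ofRealCLM.contDiff.comp
    ((contDiff_const.mul contDiff_fst).mul (contDiff_omega.comp contDiff_snd)))).cexp

lemma contDiff_phase (s t : ℝ) : ContDiff ℝ ∞ (phase s t) :=
  (contDiff_phase_prod s).comp (contDiff_const.prodMk contDiff_id)

/-- The half-wave evolution of a wave packet, in frequency space. -/
def evolved (s t : ℝ) (p ξ : Rd2) : ℂ := phase s t ξ * packet p ξ

lemma isTest_evolved (s t : ℝ) (p : Rd2) : IsTest (evolved s t p) :=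
  (isTest_packet p).smooth_mul (contDiff_phase s t)

lemma evolved_eq_zero (s t : ℝ) {p ξ : Rd2} (h : 1 / 8 ≤ ‖ξ - p‖) : evolved s t p ξ = 0 := by
  simp [evolved, packet_eq_zero h]

lemma exp_mul_packet (s t : ℝ) {p : Rd2} (hp : 1 ≤ ‖p‖) (ξ : Rd2) :
    Complex.exp (-Complex.I * ((s * t * ‖ξ‖ : ℝ) : ℂ)) * packet p ξ = evolved s t p ξ := by
  rw [evolved]
  rcases le_or_gt (1 / 8) ‖ξ - p‖ with h | h
  · simp [packet_eq_zero h]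
  · have := norm_sub_norm_le p ξ
    rw [phase, omega_eq (by rw [norm_sub_rev] at h; linarith)]

/-- Frequency profile of the initial spinor. -/
def spinorHat (p q ξ : Rd2) : Spinor := !₂[packet p ξ, packet q ξ]

lemma isTest_spinorHat (p q : Rd2) : IsTest (spinorHat p q) := by
  constructor
  · refine (PiLp.contDiff_toLp (𝕜 := ℝ) (p := 2)).comp (contDiff_pi.2 fun i => ?_)
    fin_cases i
    · exact contDiff_packet p
    · exact contDiff_packet q
  · refine HasCompactSupport.intro
      ((isCompact_closedBall p (1 / 8)).union (isCompact_closedBall q (1 / 8))) fun ξ h => ?_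
    rw [Set.mem_union, not_or] at h
    ext i
    fin_cases i
    · exact packet_eq_zero_of_notMem h.1
    · exact packet_eq_zero_of_notMem h.2


lemma Uop_spinor (s t : ℝ) {p q : Rd2} (hp : 1 ≤ ‖p‖) (hq : 1 ≤ ‖q‖) (x : Rd2) :
    Uop s t (𝓕⁻ (spinorHat p q)) x = !₂[𝓕⁻ (evolved s t p) x, 𝓕⁻ (evolved s t q) x] := by
  have h : (fun ξ => Complex.exp (-Complex.I * ((s * t * ‖ξ‖ : ℝ) : ℂ)) • spinorHat p q ξ) =
      fun ξ => !₂[evolved s t p ξ, evolved s t q ξ] := by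
    ext ξ i
    fin_cases i
    · simpa [spinorHat] using exp_mul_packet s t hp ξ
    · simpa [spinorHat] using exp_mul_packet s t hq ξ
  have hint : Integrable (fun ξ => (!₂[evolved s t p ξ, evolved s t q ξ] : Spinor)) := by
    have h2 : (fun ξ => (!₂[evolved s t p ξ, evolved s t q ξ] : Spinor)) =
        fun ξ => phase s t ξ • spinorHat p q ξ := by
      ext ξ i
      fin_cases i <;> simp [spinorHat, evolved]
    rw [h2]
    exact ((contDiff_phase s t).continuous.smul (isTest_spinorHat p q).1.continuous
      ).integrable_of_hasCompactSupport (isTest_spinorHat p q).2.smul_left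
  rw [Uop, (isTest_spinorHat p q).fmul_fourierInv, h]
  ext i
  rw [fourierInv_apply_coord hint]
  fin_cases i <;> rfl

/-- Frequency-side current of two wave packets. -/
def packetCorr (s s' t : ℝ) (p q : Rd2) : Rd2 → ℂ := corr (evolved s t p) (evolved s' t q)

lemma isTest_packetCorr (s s' t : ℝ) (p q : Rd2) : IsTest (packetCorr s s' t p q) :=
  (isTest_evolved s t p).corr (isTest_evolved s' t q)

lemma packetCorr_eq_zero (s s' t : ℝ) {p q ξ : Rd2} (h : 1 / 4 ≤ ‖ξ - (q - p)‖) :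
    packetCorr s s' t p q ξ = 0 := by
  refine corr_eq_zero fun η => ?_
  rcases le_or_gt (1 / 8) ‖η - p‖ with h1 | h1
  · exact .inl (evolved_eq_zero s t h1)
  · refine .inr (evolved_eq_zero s' t ?_)
    have := norm_sub_le (η + ξ - q) (η - p)
    rw [show η + ξ - q - (η - p) = ξ - (q - p) by abel] at this
    linarith

lemma contDiff_packetCorr_prod (s s' : ℝ) (p q : Rd2) :
    ContDiff ℝ ∞ (fun z : ℝ × Rd2 => packetCorr s s' z.1 p q z.2) := by
  have h : ContDiff ℝ ∞ (fun w : (ℝ × Rd2) × Rd2 =>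
      (starRingEnd ℂ) (phase s w.1.1 w.2 * packet p w.2) *
        (phase s' w.1.1 (w.2 + w.1.2) * packet q (w.2 + w.1.2))) := by
    have h1 : ContDiff ℝ ∞ (fun w : (ℝ × Rd2) × Rd2 => w.1.1) := contDiff_fst.comp contDiff_fst
    have h2 : ContDiff ℝ ∞ (fun w : (ℝ × Rd2) × Rd2 => w.2 + w.1.2) :=
      contDiff_snd.add (contDiff_snd.comp contDiff_fst)
    exact (Complex.conjCLE.contDiff.comp (((contDiff_phase_prod s).comp (h1.prodMk contDiff_snd)).mul
      ((contDiff_packet p).comp contDiff_snd))).mul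
      (((contDiff_phase_prod s').comp (h1.prodMk h2)).mul ((contDiff_packet q).comp h2))
  exact contDiff_integral_of_compact_support volume
    (Φ := fun z : ℝ × Rd2 => fun η : Rd2 => (starRingEnd ℂ) (phase s z.1 η * packet p η) *
        (phase s' z.1 (η + z.2) * packet q (η + z.2)))
    (isCompact_closedBall p (1 / 8))
    (fun z η hη => by simp [packet_eq_zero_of_notMem hη]) h

/-- Coefficients of `ψ̄₁ψ₂` in the components `ε_{μ0λ} ψ†α^λψ`. -/
def coeffA : Fin 3 → ℂ := ![0, Complex.I, 1]

/-- Coefficients of `ψ̄₂ψ₁` in the components `ε_{μ0λ} ψ†α^λψ`. -/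
def coeffB : Fin 3 → ℂ := ![0, -Complex.I, 1]

/-- Fourier transform of `ε_{μ0λ} ψ†α^λψ`. -/
def currentHat (s s' t : ℝ) (p q : Rd2) (μ : Fin 3) (ξ : Rd2) : ℂ :=
  coeffA μ * packetCorr s s' t p q ξ + coeffB μ * packetCorr s s' t q p ξ

lemma isTest_currentHat (s s' t : ℝ) (p q : Rd2) (μ : Fin 3) :
    IsTest (currentHat s s' t p q μ) :=
  ((isTest_packetCorr s s' t p q).smooth_mul contDiff_const).add
    ((isTest_packetCorr s s' t q p).smooth_mul contDiff_const)

lemma currentHat_eq_zero (s s' t : ℝ) {p q ξ : Rd2} (μ : Fin 3) (hpq : 1 ≤ ‖q - p‖)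
    (h : ‖ξ‖ ≤ 1 / 2) : currentHat s s' t p q μ ξ = 0 := by
  have h1 := norm_sub_norm_le (q - p) ξ
  have h2 := norm_sub_norm_le (p - q) ξ
  rw [norm_sub_rev _ ξ] at h1 h2
  rw [norm_sub_rev p q] at h2
  rw [currentHat, packetCorr_eq_zero s s' t (by linarith), packetCorr_eq_zero s s' t (by linarith)]
  simp

lemma Fcurr_eq (s2 s3 : Bool) {p q : Rd2} (hp : 1 ≤ ‖p‖) (hq : 1 ≤ ‖q‖) (μ : Fin 3) (t : ℝ) :
    Fcurr s2 s3 (𝓕⁻ (spinorHat p q)) μ 0 t = 𝓕⁻ (currentHat (sv s2) (sv s3) t p q μ) := by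
  ext x
  change _ = 𝓕⁻ (fun ξ => coeffA μ * packetCorr (sv s2) (sv s3) t p q ξ +
    coeffB μ * packetCorr (sv s2) (sv s3) t q p ξ) x
  rw [fourierInv_linear_comb (isTest_packetCorr ..).integrable (isTest_packetCorr ..).integrable]
  unfold packetCorr
  rw [fourierInv_corr (isTest_evolved ..) (isTest_evolved ..),
    fourierInv_corr (isTest_evolved ..) (isTest_evolved ..)]
  simp only [Fcurr, Uop_spinor _ _ hp hq]
  fin_cases μ <;>
    simp [Fin.sum_univ_three, eps, pairD, mulVecE, alphaM, sigma1, sigma2, coeffA, coeffB,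
      Fin.sum_univ_two] <;> ring

/-- The modified Riesz symbols, smoothed out at low frequencies. -/
def rieszSmooth (s : ℝ) (μ : Fin 3) (ξ : Rd2) : ℂ :=
  if μ = 0 then -1 else ((-(s * ξ (sIdx μ)) / omega ξ : ℝ) : ℂ)

lemma contDiff_rieszSmooth (s : ℝ) (μ : Fin 3) : ContDiff ℝ ∞ (rieszSmooth s μ) := by
  unfold rieszSmooth
  split_ifs
  · exact contDiff_const
  · refine Complex.ofRealCLM.contDiff.comp (ContDiff.div (ContDiff.neg (contDiff_const.mul ?_))
      contDiff_omega fun ξ => (omega_pos ξ).ne')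
    exact (EuclideanSpace.proj (𝕜 := ℝ) (sIdx μ) : Rd2 →L[ℝ] ℝ).contDiff

lemma rsym_mul_currentHat (s1 s s' t : ℝ) {p q : Rd2} (hpq : 1 ≤ ‖q - p‖) (μ : Fin 3) (ξ : Rd2) :
    rsym s1 μ ξ * currentHat s s' t p q μ ξ = rieszSmooth s1 μ ξ * currentHat s s' t p q μ ξ := by
  rcases le_or_gt ‖ξ‖ (1 / 2) with h | h
  · simp [currentHat_eq_zero s s' t μ hpq h]
  · rw [rsym, rieszSmooth, omega_eq h.le]

/-- Frequency-side source term `R^μ(ε_{μ0λ} ψ†α^λψ)`. -/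
def sourceHat (s1 s s' t : ℝ) (p q ξ : Rd2) : ℂ :=
  ∑ μ : Fin 3, rieszSmooth s1 μ ξ * currentHat s s' t p q μ ξ

lemma isTest_sourceHat (s1 s s' t : ℝ) (p q : Rd2) : IsTest (sourceHat s1 s s' t p q) :=
  isTest_sum _ fun μ => (isTest_currentHat s s' t p q μ).smooth_mul (contDiff_rieszSmooth s1 μ)

lemma sourceHat_eq_zero (s1 s s' t : ℝ) {p q ξ : Rd2} (hpq : 1 ≤ ‖q - p‖)
    (h : ‖ξ‖ ≤ 1 / 2) : sourceHat s1 s s' t p q ξ = 0 := by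
  simp [sourceHat, currentHat_eq_zero s s' t _ hpq h]

/-- Integrand of the Duhamel formula, in frequency space. -/
def duhamelHat (s1 s s' t : ℝ) (p q : Rd2) (t' : ℝ) (ξ : Rd2) : ℂ :=
  phase s1 (t - t') ξ * sourceHat s1 s s' t' p q ξ

lemma duhamelHat_eq_zero_of_notMem (s1 s s' t t' : ℝ) {p q ξ : Rd2}
    (h : ξ ∉ Metric.closedBall 0 (‖q - p‖ + 1 / 4)) : duhamelHat s1 s s' t p q t' ξ = 0 := by
  rw [mem_closedBall_zero_iff, not_le] at h
  have h1 := norm_sub_norm_le ξ (q - p)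
  have h2 := norm_sub_norm_le ξ (p - q)
  rw [norm_sub_rev p q] at h2
  simp only [duhamelHat, sourceHat, currentHat]
  rw [packetCorr_eq_zero s s' t' (by linarith), packetCorr_eq_zero s s' t' (by linarith)]
  simp

lemma contDiff_duhamelHat_prod (s1 s s' t : ℝ) (p q : Rd2) :
    ContDiff ℝ ∞ (fun z : ℝ × Rd2 => duhamelHat s1 s s' t p q z.1 z.2) := by
  refine ContDiff.mul ((contDiff_phase_prod s1).comp
    ((contDiff_const.sub contDiff_fst).prodMk contDiff_snd)) ?_
  refine ContDiff.sum fun μ _ => ((contDiff_rieszSmooth s1 μ).comp contDiff_snd).mul ?_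
  exact (contDiff_const.mul (contDiff_packetCorr_prod s s' p q)).add
    (contDiff_const.mul (contDiff_packetCorr_prod s s' q p))

lemma Uop_riesz_Fcurr (s1 : ℝ) (s2 s3 : Bool) {p q : Rd2} (hp : 1 ≤ ‖p‖) (hq : 1 ≤ ‖q‖)
    (hpq : 1 ≤ ‖q - p‖) (t t' : ℝ) :
    Uop s1 (t - t') (fun y => ∑ μ : Fin 3,
      riesz s1 μ (Fcurr s2 s3 (𝓕⁻ (spinorHat p q)) μ 0 t') y) =
    𝓕⁻ (duhamelHat s1 (sv s2) (sv s3) t p q t') := by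
  have h : (fun y => ∑ μ : Fin 3, riesz s1 μ (Fcurr s2 s3 (𝓕⁻ (spinorHat p q)) μ 0 t') y) =
      𝓕⁻ (sourceHat s1 (sv s2) (sv s3) t' p q) := by
    ext y
    change _ = 𝓕⁻ (fun ξ => ∑ μ : Fin 3,
      rieszSmooth s1 μ ξ * currentHat (sv s2) (sv s3) t' p q μ ξ) y
    rw [fourierInv_sum_apply _ fun μ => ((isTest_currentHat (sv s2) (sv s3) t' p q μ).smooth_mul
      (contDiff_rieszSmooth s1 μ)).integrable]
    refine Finset.sum_congr rfl fun μ _ => ?_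
    rw [Fcurr_eq s2 s3 hp hq, riesz, (isTest_currentHat ..).fmul_fourierInv]
    simp only [smul_eq_mul, rsym_mul_currentHat s1 _ _ t' hpq]
  rw [h, Uop, (isTest_sourceHat ..).fmul_fourierInv]
  congr 1
  ext ξ
  rw [duhamelHat, smul_eq_mul]
  rcases le_or_gt ‖ξ‖ (1 / 2) with h | h
  · simp [sourceHat_eq_zero _ _ _ _ hpq h]
  · rw [phase, omega_eq h.le]

/-- Fourier transform of the Duhamel integral. -/
def solutionHat (s1 s s' t : ℝ) (p q ξ : Rd2) : ℂ := ∫ t' in (0:ℝ)..t, duhamelHat s1 s s' t p q t' ξ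

lemma isTest_solutionHat (s1 s s' : ℝ) {t : ℝ} (ht : 0 ≤ t) (p q : Rd2) :
    IsTest (solutionHat s1 s s' t p q) := by
  constructor
  · let cutoff : ContDiffBump (0 : ℝ) := ⟨t + 1, t + 2, by linarith, by linarith⟩
    have hΦ : ContDiff ℝ ∞ (fun z : Rd2 × ℝ =>
        (cutoff z.2 : ℂ) * duhamelHat s1 s s' t p q z.2 z.1) := by
      have h1 : ContDiff ℝ ∞ fun z : Rd2 × ℝ => (cutoff z.2 : ℂ) :=
        Complex.ofRealCLM.contDiff.comp (cutoff.contDiff.comp contDiff_snd)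
      have h2 : ContDiff ℝ ∞ fun z : Rd2 × ℝ => duhamelHat s1 s s' t p q z.2 z.1 :=
        (contDiff_duhamelHat_prod s1 s s' t p q).comp (f := fun z : Rd2 × ℝ => (z.2, z.1))
          (contDiff_snd.prodMk contDiff_fst)
      exact h1.mul h2
    have h := contDiff_integral_of_compact_support (volume.restrict (Set.Ioc 0 t))
      (Φ := fun (ξ : Rd2) (t' : ℝ) => (cutoff t' : ℂ) * duhamelHat s1 s s' t p q t' ξ)
      (isCompact_closedBall (0 : ℝ) (t + 2)) (fun ξ t' ht' => by
        rw [cutoff.zero_of_le_dist (not_le.1 (mt Metric.mem_closedBall.2 ht')).le]; simp) hΦ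
    convert h using 2 with ξ
    rw [solutionHat, intervalIntegral.integral_of_le ht]
    refine setIntegral_congr_fun measurableSet_Ioc fun t' ht' => ?_
    have : cutoff t' = 1 := cutoff.one_of_mem_closedBall <| by
      rw [mem_closedBall_zero_iff, Real.norm_eq_abs, abs_of_pos ht'.1]
      change t' ≤ t + 1
      linarith [ht'.2]
    simp [this]
  · refine HasCompactSupport.intro (isCompact_closedBall (0 : Rd2) (‖q - p‖ + 1 / 4)) fun ξ h => ?_
    simp [solutionHat, duhamelHat_eq_zero_of_notMem _ _ _ _ _ h]

lemma integrable_prod_of_continuous {E : Type*} [NormedAddCommGroup E] {f : ℝ → Rd2 → E} {t r : ℝ}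
    (c : Rd2) (hf : Continuous (Function.uncurry f))
    (h0 : ∀ t' ξ, ξ ∉ Metric.closedBall c r → f t' ξ = 0) :
    Integrable (Function.uncurry f) ((volume.restrict (Set.uIoc 0 t)).prod volume) := by
  have h1 : IntegrableOn (Function.uncurry f) (Set.uIcc 0 t ×ˢ Metric.closedBall c r)
      (volume.prod volume) :=
    hf.continuousOn.integrableOn_compact (isCompact_uIcc.prod (isCompact_closedBall c r))
  have h2 : IntegrableOn (Function.uncurry f) (Set.uIcc 0 t ×ˢ Set.univ)
      (volume.prod volume) :=
    h1.of_forall_sdiff_eq_zero (measurableSet_uIcc.prod .univ) fun z hz =>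
      h0 _ _ fun h => hz.2 ⟨hz.1.1, h⟩
  have h3 := h2.mono_set (Set.prod_mono_left Set.uIoc_subset_uIcc (t := Set.univ))
  rwa [IntegrableOn, ← Measure.prod_restrict, Measure.restrict_univ] at h3

lemma integral_fourierInv_duhamelHat (s1 s s' t : ℝ) (p q x : Rd2) :
    ∫ t' in (0:ℝ)..t, 𝓕⁻ (duhamelHat s1 s s' t p q t') x =
      𝓕⁻ (solutionHat s1 s s' t p q) x := by
  simp only [Real.fourierInv_eq, solutionHat]
  rw [intervalIntegral_integral_swap]
  · simp only [Circle.smul_def, intervalIntegral.integral_smul]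
  · refine integrable_prod_of_continuous 0 (r := ‖q - p‖ + 1 / 4) ?_ fun t' ξ h => by
      simp [duhamelHat_eq_zero_of_notMem _ _ _ _ _ h]
    have h1 := (contDiff_duhamelHat_prod s1 s s' t p q).continuous
    have h2 : Continuous fun z : ℝ × Rd2 => Real.fourierChar (inner ℝ z.2 x) :=
      Real.continuous_fourierChar.comp (continuous_snd.inner continuous_const)
    exact h2.smul h1

lemma fourier_Fnu {p q : Rd2} (hp : 1 ≤ ‖p‖) (hq : 1 ≤ ‖q‖) (hpq : 1 ≤ ‖q - p‖) {t : ℝ}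
    (ht : 0 ≤ t) :
    𝓕 (Fnu (𝓕⁻ (spinorHat p q)) 0 t) = fun ξ => ∑ s1 : Bool, ∑ s2 : Bool, ∑ s3 : Bool,
      solutionHat (sv s1) (sv s2) (sv s3) t p q ξ := by
  have h3 (s1 s2 : Bool) := isTest_sum Finset.univ fun s3 : Bool =>
    isTest_solutionHat (sv s1) (sv s2) (sv s3) ht p q
  have h2 (s1 : Bool) := isTest_sum Finset.univ (h3 s1)
  have h1 := isTest_sum Finset.univ h2
  rw [← h1.fourier_fourierInv]
  congr 1
  ext x
  rw [fourierInv_sum_apply _ fun i => (h2 i).integrable]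
  refine Finset.sum_congr rfl fun s1 _ => ?_
  rw [fourierInv_sum_apply _ fun i => (h3 s1 i).integrable]
  refine Finset.sum_congr rfl fun s2 _ => ?_
  rw [fourierInv_sum_apply _ fun i => (isTest_solutionHat (sv s1) (sv s2) (sv i) ht p q).integrable]
  refine Finset.sum_congr rfl fun s3 _ => ?_
  rw [← integral_fourierInv_duhamelHat]
  simp only [Uop_riesz_Fcurr _ s2 s3 hp hq hpq]

lemma phase_sv (b : Bool) (t : ℝ) (ξ : Rd2) : phase (sv b) t ξ =
    (Real.cos (t * omega ξ) : ℂ) - sv b * Complex.I * (Real.sin (t * omega ξ) : ℂ) := by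
  have : -Complex.I * ((sv b * t * omega ξ : ℝ) : ℂ) =
      ((-(sv b * (t * omega ξ)) : ℝ) : ℂ) * Complex.I := by
    push_cast; ring
  rw [phase, this, Complex.exp_mul_I, ← Complex.ofReal_cos, ← Complex.ofReal_sin]
  cases b <;> simp [sv] <;> ring

/-- Product of the two packet profiles entering the cross-correlation at frequency `ξ`. -/
def profile (p q ξ η : Rd2) : ℝ := bump (η - p) * bump (η + ξ - q)

lemma continuous_profile (p q ξ : Rd2) : Continuous (profile p q ξ) :=
  (bump.continuous.comp (continuous_id.sub continuous_const)).mul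
    (bump.continuous.comp ((continuous_id.add continuous_const).sub continuous_const))

lemma profile_nonneg (p q ξ η : Rd2) : 0 ≤ profile p q ξ η :=
  mul_nonneg bump.nonneg bump.nonneg

lemma profile_eq_zero_of_notMem {p q ξ η : Rd2} (h : η ∉ Metric.closedBall p (1 / 8)) :
    profile p q ξ η = 0 := by
  have : packet p η = 0 := packet_eq_zero_of_notMem h
  rw [packet, Complex.ofReal_eq_zero] at this
  simp [profile, this]

/-- The correlation integral left after summing over the signs. -/
def cosCorr (p q ξ : Rd2) (t : ℝ) : ℝ :=
  ∫ η, Real.cos (t * omega η) * Real.cos (t * omega (η + ξ)) * profile p q ξ η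

lemma sum_packetCorr (t : ℝ) (p q ξ : Rd2) :
    ∑ s2 : Bool, ∑ s3 : Bool, packetCorr (sv s2) (sv s3) t p q ξ = 4 * (cosCorr p q ξ t : ℂ) := by
  have hint (s2 s3 : Bool) : Integrable (fun η =>
      (starRingEnd ℂ) (evolved (sv s2) t p η) * evolved (sv s3) t q (η + ξ)) := by
    refine Continuous.integrable_of_hasCompactSupport ?_ ?_
    · exact (Complex.continuous_conj.comp (isTest_evolved ..).1.continuous).mul
        ((isTest_evolved ..).1.continuous.comp (continuous_id.add continuous_const))
    · exact ((isTest_evolved (sv s2) t p).2.comp_left (map_zero (starRingEnd ℂ))).mul_right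
  simp only [packetCorr, corr]
  simp_rw [← integral_finsetSum Finset.univ fun s3 _ => hint _ s3]
  rw [← integral_finsetSum Finset.univ fun s2 _ => integrable_finsetSum _ fun s3 _ => hint s2 s3,
    cosCorr, ← integral_complex_ofReal, ← integral_const_mul]
  congr 1
  ext η
  simp only [evolved, phase_sv, packet, profile, Fintype.sum_bool]
  simp only [map_mul, map_sub, Complex.conj_ofReal, Complex.conj_I, sv]
  push_cast
  ring_nf

lemma sum_duhamelHat (t t' : ℝ) {p q ξ : Rd2} (hpq : 1 ≤ ‖q - p‖) (hξ : ‖ξ - (q - p)‖ < 1 / 4) :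
    ∑ s1 : Bool, ∑ s2 : Bool, ∑ s3 : Bool, duhamelHat (sv s1) (sv s2) (sv s3) t p q t' ξ =
      8 * Complex.I * (Complex.I * ξ 0 + ξ 1) / omega ξ *
        ((Real.sin ((t - t') * omega ξ) * cosCorr p q ξ t' : ℝ) : ℂ) := by
  have h0 (s2 s3 : Bool) : packetCorr (sv s2) (sv s3) t' q p ξ = 0 := by
    refine packetCorr_eq_zero _ _ _ ?_
    have := norm_sub_le (ξ - (p - q)) (ξ - (q - p))
    rw [show ξ - (p - q) - (ξ - (q - p)) = (2 : ℝ) • (q - p) by module, norm_smul,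
      Real.norm_ofNat] at this
    linarith
  have h1 (s1 s2 s3 : Bool) : duhamelHat (sv s1) (sv s2) (sv s3) t p q t' ξ =
      phase (sv s1) (t - t') ξ * (-(sv s1) / omega ξ * (Complex.I * ξ 0 + ξ 1)) *
        packetCorr (sv s2) (sv s3) t' p q ξ := by
    simp [duhamelHat, sourceHat, currentHat, h0, Fin.sum_univ_three, rieszSmooth, coeffA, sIdx]
    ring
  simp only [h1, ← Finset.mul_sum, sum_packetCorr]
  rw [Fintype.sum_bool, phase_sv, phase_sv]
  have := (omega_pos ξ).ne'
  simp only [sv]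
  push_cast
  simp
  ring

lemma norm_I_mul_add (ξ : Rd2) : ‖(Complex.I * ξ 0 + ξ 1 : ℂ)‖ = ‖ξ‖ := by
  rw [EuclideanSpace.norm_eq, Fin.sum_univ_two, add_comm, mul_comm, Complex.norm_add_mul_I]
  simp [add_comm]

lemma norm_sum_solutionHat (t : ℝ) {p q ξ : Rd2} (hpq : 1 ≤ ‖q - p‖)
    (hξ : ‖ξ - (q - p)‖ < 1 / 4) :
    ‖∑ s1 : Bool, ∑ s2 : Bool, ∑ s3 : Bool, solutionHat (sv s1) (sv s2) (sv s3) t p q ξ‖ =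
      8 * |∫ t' in (0:ℝ)..t, Real.sin ((t - t') * omega ξ) * cosCorr p q ξ t'| := by
  have hint (s1 s2 s3 : Bool) : IntervalIntegrable
      (fun t' => duhamelHat (sv s1) (sv s2) (sv s3) t p q t' ξ) volume 0 t := by
    have : Continuous (fun t' => duhamelHat (sv s1) (sv s2) (sv s3) t p q t' ξ) :=
      (contDiff_duhamelHat_prod (sv s1) (sv s2) (sv s3) t p q).continuous.comp
        (continuous_id.prodMk continuous_const)
    exact this.intervalIntegrable _ _
  have hsum : ∑ s1 : Bool, ∑ s2 : Bool, ∑ s3 : Bool, solutionHat (sv s1) (sv s2) (sv s3) t p q ξ =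
      ∫ t' in (0:ℝ)..t, ∑ s1 : Bool, ∑ s2 : Bool, ∑ s3 : Bool,
        duhamelHat (sv s1) (sv s2) (sv s3) t p q t' ξ := by
    simp only [solutionHat, Fintype.sum_bool]
    have h2 (s1 s2) := (hint s1 s2 true).add (hint s1 s2 false)
    have h3 (s1) := (h2 s1 true).add (h2 s1 false)
    rw [intervalIntegral.integral_add (h3 true) (h3 false)]
    simp only [intervalIntegral.integral_add (h2 _ _) (h2 _ _),
      intervalIntegral.integral_add (hint _ _ _) (hint _ _ _)]
  have hω : omega ξ = ‖ξ‖ := omega_eq <| by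
    have := norm_sub_norm_le (q - p) ξ
    rw [norm_sub_rev _ ξ] at this
    linarith
  simp only [hsum, sum_duhamelHat t _ hpq hξ]
  rw [intervalIntegral.integral_const_mul, intervalIntegral.integral_ofReal, norm_mul, norm_div,
    norm_mul, norm_I_mul_add, Complex.norm_real, Complex.norm_real, Real.norm_eq_abs,
    Real.norm_eq_abs, abs_of_pos (omega_pos ξ), ← hω, mul_div_assoc, div_self (omega_pos ξ).ne']
  simp

lemma integral_sin_mul_cosCorr (t : ℝ) (p q ξ : Rd2) :
    ∫ t' in (0:ℝ)..t, Real.sin ((t - t') * omega ξ) * cosCorr p q ξ t' =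
      ∫ η, (∫ t' in (0:ℝ)..t, Real.sin ((t - t') * omega ξ) *
        (Real.cos (t' * omega η) * Real.cos (t' * omega (η + ξ)))) * profile p q ξ η := by
  simp only [cosCorr, ← integral_const_mul]
  rw [intervalIntegral_integral_swap]
  · congr 1
    ext η
    rw [← intervalIntegral.integral_mul_const]
    congr 1
    ext t'
    ring
  · refine integrable_prod_of_continuous p (r := 1 / 8) ?_ fun t' η h => by
      simp [profile_eq_zero_of_notMem h]
    have := contDiff_omega.continuous
    have := continuous_profile p q ξ
    unfold Function.uncurry
    fun_prop

lemma integral_sin_mul_cos_mul_cos_ge {a x y t : ℝ} (ha : 3 / 4 ≤ a) (ha' : a ≤ 5 / 4) (ht : 0 < t)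
    (ht' : t ≤ 1 / 2) (hxy : |x - y| ≤ a) (hB : 2 + 64 / t ^ 2 ≤ x + y) :
    t ^ 2 / 64 ≤ ∫ t' in (0:ℝ)..t, Real.sin ((t - t') * a) *
      (Real.cos (t' * x) * Real.cos (t' * y)) := by
  have hpos : 0 < 64 / t ^ 2 := by positivity
  set B := x + y with hBdef
  have hBa : 64 / t ^ 2 ≤ B - a := by linarith
  have hBa' : 0 < B - a := by linarith
  have hBa'' : 0 < B + a := by linarith
  let L : ℝ → ℝ := fun u => 1 / 4 * Real.sin ((t - u) * a) +
    1 / 2 * (Real.sin ((t - u) * a) * Real.cos (u * B))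
  let G : ℝ → ℝ := fun u => Real.cos ((t - u) * a) / (4 * a) +
    (-(Real.cos (t * a + (B - a) * u) / (B - a)) + Real.cos (t * a - (B + a) * u) / (B + a)) / 4
  have hG (u : ℝ) : HasDerivAt G (L u) u := by
    have h1 : HasDerivAt (fun u : ℝ => (t - u) * a) (-1 * a) u :=
      ((hasDerivAt_id u).const_sub t).mul_const a
    have h2 : HasDerivAt (fun u : ℝ => t * a + (B - a) * u) ((B - a) * 1) u :=
      ((hasDerivAt_id u).const_mul (B - a)).const_add (t * a)
    have h3 : HasDerivAt (fun u : ℝ => t * a - (B + a) * u) (-((B + a) * 1)) u :=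
      ((hasDerivAt_id u).const_mul (B + a)).const_sub (t * a)
    have h := (h1.cos.div_const (4 * a)).add
      (((h2.cos.div_const (B - a)).neg.add (h3.cos.div_const (B + a))).div_const 4)
    refine HasDerivAt.congr_deriv (f := G) h ?_
    have e1 : t * a + (B - a) * u = (t - u) * a + u * B := by ring
    have e2 : t * a - (B + a) * u = (t - u) * a - u * B := by ring
    simp only [L, e1, e2, Real.sin_add, Real.sin_sub]
    have : a ≠ 0 := by linarith
    field_simp
    ring
  have hLc : Continuous L := by fun_prop
  have hint : ∫ u in (0:ℝ)..t, L u = G t - G 0 :=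
    intervalIntegral.integral_eq_sub_of_hasDerivAt (fun u _ => hG u) (hLc.intervalIntegrable _ _)
  have hmono : ∫ u in (0:ℝ)..t, L u ≤ ∫ t' in (0:ℝ)..t, Real.sin ((t - t') * a) *
      (Real.cos (t' * x) * Real.cos (t' * y)) := by
    refine intervalIntegral.integral_mono_on ht.le (hLc.intervalIntegrable _ _)
      (Continuous.intervalIntegrable (by fun_prop) _ _) fun u hu => ?_
    have hs : 0 ≤ Real.sin ((t - u) * a) := by
      refine Real.sin_nonneg_of_nonneg_of_le_pi (mul_nonneg (by linarith [hu.2]) (by linarith)) ?_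
      nlinarith [Real.pi_gt_three, hu.1, hu.2]
    have hc : 1 / 2 ≤ Real.cos (u * x - u * y) := by
      have h1 : |u * x - u * y| ≤ 5 / 8 := by
        rw [← mul_sub, abs_mul, abs_of_nonneg hu.1]
        nlinarith [hu.1, hu.2, abs_nonneg (x - y)]
      have h2 := Real.one_sub_sq_div_two_le_cos (x := u * x - u * y)
      have h3 : (u * x - u * y) ^ 2 ≤ (5 / 8) ^ 2 :=
        sq_le_sq.2 (by rwa [abs_of_pos (by norm_num : (0:ℝ) < 5 / 8)])
      linarith
    have e : Real.cos (u * x) * Real.cos (u * y) =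
        1 / 2 * Real.cos (u * x - u * y) + 1 / 2 * Real.cos (u * B) := by
      rw [hBdef, mul_add, Real.cos_add, Real.cos_sub]; ring
    rw [e]
    simp only [L]
    nlinarith
  refine le_trans ?_ hmono
  rw [hint]
  have hcos : Real.cos (t * a) ≤ 1 - 2 / Real.pi ^ 2 * (t * a) ^ 2 := by
    refine Real.cos_le_one_sub_mul_cos_sq ?_
    rw [abs_of_pos (by positivity)]
    nlinarith [Real.pi_gt_three]
  have hmain : t ^ 2 / 32 ≤ (1 - Real.cos (t * a)) / (4 * a) := by
    rw [le_div_iff₀ (by linarith)]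
    have hpi : 1 / 5 ≤ 2 / Real.pi ^ 2 := by
      rw [div_le_div_iff₀ (by norm_num) (by positivity)]
      nlinarith [Real.pi_lt_d2, Real.pi_gt_three]
    nlinarith [mul_le_mul_of_nonneg_right hpi (sq_nonneg (t * a)),
      mul_nonneg (sq_nonneg t) (by linarith : 0 ≤ a)]
  have hsmall : 1 / (B - a) ≤ t ^ 2 / 64 := by
    rw [div_le_div_iff₀ hBa' (by norm_num)]
    rw [div_le_iff₀ (by positivity)] at hBa
    linarith
  have b1 (z : ℝ) : |Real.cos z / (B - a)| ≤ 1 / (B - a) := by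
    rw [abs_div, abs_of_pos hBa']
    gcongr
    exact Real.abs_cos_le_one z
  have b2 (z : ℝ) : |Real.cos z / (B + a)| ≤ 1 / (B - a) := by
    rw [abs_div, abs_of_pos hBa'']
    gcongr
    · exact Real.abs_cos_le_one z
    · linarith
  have c1 := abs_le.1 (b1 (t * a + (B - a) * t))
  have c2 := abs_le.1 (b1 (t * a + (B - a) * 0))
  have c3 := abs_le.1 (b2 (t * a - (B + a) * t))
  have c4 := abs_le.1 (b2 (t * a - (B + a) * 0))
  have e : (1 - Real.cos (t * a)) / (4 * a) = 1 / (4 * a) - Real.cos (t * a) / (4 * a) :=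
    sub_div _ _ _
  simp only [G, sub_self, zero_mul, Real.cos_zero, sub_zero] at *
  linarith [c1.1, c1.2, c2.1, c2.2, c3.1, c3.2, c4.1, c4.2]

lemma integral_kernel_profile_ge {p q ξ : Rd2} {t : ℝ} (ht : 0 < t) (ht' : t ≤ 1 / 2)
    (hp : 2 + 64 / t ^ 2 ≤ ‖p‖) (hq : 1 ≤ ‖q‖) (hpq : ‖q - p‖ = 1)
    (hξ : ‖ξ - (q - p)‖ < 1 / 32) :
    t ^ 2 / 64 * volume.real (Metric.ball (0 : Rd2) (1 / 32)) ≤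
      ∫ η, (∫ t' in (0:ℝ)..t, Real.sin ((t - t') * omega ξ) *
        (Real.cos (t' * omega η) * Real.cos (t' * omega (η + ξ)))) * profile p q ξ η := by
  have hpos : 0 < 64 / t ^ 2 := by positivity
  have hball : volume.real (Metric.ball (0 : Rd2) (1 / 32)) =
      volume.real (Metric.ball p (1 / 32)) := by
    rw [Measure.real, Measure.real, Measure.addHaar_ball_center volume p]
  have hξ1 : ‖ξ‖ ≤ 33 / 32 := by
    have := norm_sub_norm_le ξ (q - p); linarith
  have hξ2 : 31 / 32 ≤ ‖ξ‖ := by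
    have := norm_sub_norm_le (q - p) ξ; rw [norm_sub_rev _ ξ] at this; linarith
  rw [hball, mul_comm, ← smul_eq_mul, ← integral_indicator_const _ measurableSet_ball]
  have hω := contDiff_omega.continuous
  have hcont : Continuous fun η => (∫ t' in (0:ℝ)..t, Real.sin ((t - t') * omega ξ) *
      (Real.cos (t' * omega η) * Real.cos (t' * omega (η + ξ)))) * profile p q ξ η := by
    refine Continuous.mul ?_ (continuous_profile p q ξ)
    refine intervalIntegral.continuous_parametric_intervalIntegral_of_continuous' ?_ _ _
    unfold Function.uncurry
    fun_prop
  refine integral_mono ?_ ?_ fun η => ?_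
  · exact (integrable_indicator_iff measurableSet_ball).2
      (integrableOn_const (measure_ball_lt_top.ne) (by simp))
  · refine hcont.integrable_of_hasCompactSupport (HasCompactSupport.intro
      (isCompact_closedBall p (1 / 8)) fun η hη => ?_)
    rw [profile_eq_zero_of_notMem hη, mul_zero]
  have hnn := profile_nonneg p q ξ η
  have hind : (Metric.ball p (1 / 32)).indicator (fun _ => t ^ 2 / 64) η ≤
      t ^ 2 / 64 * profile p q ξ η := by
    by_cases hη : η ∈ Metric.ball p (1 / 32)
    · rw [mem_ball_iff_norm] at hη
      have h1 : bump (η - p) = 1 := bump.one_of_mem_closedBall <| by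
        rw [mem_closedBall_zero_iff]; change _ ≤ (1 / 16 : ℝ); linarith
      have h2 : bump (η + ξ - q) = 1 := bump.one_of_mem_closedBall <| by
        rw [mem_closedBall_zero_iff, show η + ξ - q = (η - p) + (ξ - (q - p)) by abel]
        change _ ≤ (1 / 16 : ℝ)
        linarith [norm_add_le (η - p) (ξ - (q - p))]
      rw [Set.indicator_of_mem (by rwa [mem_ball_iff_norm]), profile, h1, h2]
      simp
    · rw [Set.indicator_of_notMem hη]
      positivity
  refine hind.trans ?_
  by_cases h0 : profile p q ξ η = 0
  · simp [h0]
  refine mul_le_mul_of_nonneg_right ?_ hnn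
  have hηp : ‖η - p‖ < 1 / 8 := by
    by_contra! h
    exact h0 (by simp [profile, bump.zero_of_le_dist (x := η - p) (by simpa [bump] using h)])
  have hηq : ‖η + ξ - q‖ < 1 / 8 := by
    by_contra! h
    exact h0 (by simp [profile, bump.zero_of_le_dist (x := η + ξ - q) (by simpa [bump] using h)])
  have n1 := norm_sub_norm_le p η
  have n2 := norm_sub_norm_le q (η + ξ)
  rw [norm_sub_rev _ η] at n1
  rw [norm_sub_rev _ (η + ξ)] at n2
  have n3 : |‖η‖ - ‖η + ξ‖| ≤ ‖ξ‖ := by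
    simpa using abs_norm_sub_norm_le η (η + ξ)
  rw [omega_eq (ξ := ξ) (by linarith), omega_eq (ξ := η) (by linarith),
    omega_eq (ξ := η + ξ) (by linarith)]
  exact integral_sin_mul_cos_mul_cos_ge (by linarith) (by linarith) ht ht' n3 (by linarith)

lemma LPnorm_zero_le_sobNorm {E : Type*} [NormedAddCommGroup E] [NormedSpace ℂ E] (s : ℝ)
    (f : Rd2 → E) : LPnorm 0 f ≤ sobNorm s f := by
  have h := ENNReal.le_tsum (f := fun k : ℕ => (2:ℝ≥0∞) ^ (2 * s * (k:ℝ)) * (LPnorm k f)^2) 0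
  have h2 := ENNReal.rpow_le_rpow h (by norm_num : (0:ℝ) ≤ 1 / 2)
  refine le_trans (le_of_eq ?_) h2
  simp only [Nat.cast_zero, mul_zero, ENNReal.rpow_zero, one_mul]
  rw [← ENNReal.rpow_natCast, ← ENNReal.rpow_mul]
  norm_num

lemma disjoint_LPset {k K : ℕ} (hK : 1 ≤ K) (hk : k ≠ K) {ξ : Rd2} (h : ξ ∈ LPset k) :
    ¬ ((2:ℝ) ^ K ≤ ‖ξ‖ ∧ ‖ξ‖ < 2 ^ (K + 1)) := by
  rintro ⟨h1, h2⟩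
  have hlt {a b : ℕ} (hab : (2:ℝ) ^ a < 2 ^ b) : a < b :=
    (pow_lt_pow_iff_right₀ (by norm_num)).1 hab
  change LPcond k ‖ξ‖ at h
  unfold LPcond at h
  split_ifs at h with h0
  · have := hlt (a := K) (b := 1) (by linarith)
    omega
  · have a1 := hlt (h.1.trans_lt h2)
    have a2 := hlt (h1.trans_lt h.2)
    omega

lemma sobNorm_sq {E : Type*} [NormedAddCommGroup E] [NormedSpace ℂ E] (s : ℝ) {K : ℕ}
    {f : Rd2 → E} (hK : 1 ≤ K)
    (hf : ∀ ξ, 𝓕 f ξ ≠ 0 → (2:ℝ) ^ K ≤ ‖ξ‖ ∧ ‖ξ‖ < 2 ^ (K + 1)) :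
    (sobNorm s f) ^ 2 ≤ ((2:ℝ≥0∞) ^ (2 * s)) ^ K * (eLpNorm (𝓕 f) 2 volume) ^ 2 := by
  have h0 (k : ℕ) (hk : k ≠ K) : LPnorm k f = 0 := by
    have : (LPset k).indicator (𝓕 f) = 0 := by
      ext ξ
      by_cases h : ξ ∈ LPset k
      · rw [Set.indicator_of_mem h]
        by_contra h2
        exact disjoint_LPset hK hk h (hf ξ h2)
      · rw [Set.indicator_of_notMem h]; rfl
    rw [LPnorm, this, eLpNorm_zero]
  rw [sobNorm, tsum_eq_single K fun k hk => by simp [h0 k hk], ← ENNReal.rpow_natCast _ 2,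
    ← ENNReal.rpow_mul, ENNReal.rpow_mul 2 (2 * s), ENNReal.rpow_natCast]
  simp only [Nat.cast_ofNat, one_div, ne_eq, OfNat.ofNat_ne_zero, not_false_eq_true,
    inv_mul_cancel₀, ENNReal.rpow_one]
  gcongr
  exact eLpNorm_indicator_le _

lemma eLpNorm_spinorHat_add (p c : Rd2) :
    eLpNorm (spinorHat p (p + c)) 2 volume = eLpNorm (spinorHat 0 c) 2 volume := by
  have h : spinorHat p (p + c) = spinorHat 0 c ∘ fun ξ => ξ - p := by
    ext ξ
    simp [spinorHat, packet, sub_sub]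
  rw [h, eLpNorm_comp_measurePreserving
    (isTest_spinorHat 0 c).1.continuous.aestronglyMeasurable
    (measurePreserving_sub_right volume p)]

lemma spinorHat_ne_zero {p q ξ : Rd2} (h : spinorHat p q ξ ≠ 0) :
    ‖ξ - p‖ < 1 / 8 ∨ ‖ξ - q‖ < 1 / 8 := by
  by_contra! h2
  refine h ?_
  ext i
  fin_cases i
  · exact packet_eq_zero h2.1
  · exact packet_eq_zero h2.2

lemma le_LPnorm_zero_Fnu {p q : Rd2} {t : ℝ} (ht : 0 < t) (ht' : t ≤ 1 / 2)
    (hp : 2 + 64 / t ^ 2 ≤ ‖p‖) (hq : 1 ≤ ‖q‖) (hpq : ‖q - p‖ = 1) :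
    eLpNorm ((Metric.ball (q - p) (1 / 32)).indicator
      fun _ => 8 * (t ^ 2 / 64 * volume.real (Metric.ball (0 : Rd2) (1 / 32)))) 2 volume ≤
    LPnorm 0 (Fnu (𝓕⁻ (spinorHat p q)) 0 t) := by
  have hpos : 0 < 64 / t ^ 2 := by positivity
  refine eLpNorm_mono fun ξ => ?_
  by_cases hξ : ξ ∈ Metric.ball (q - p) (1 / 32)
  · rw [Set.indicator_of_mem hξ]
    rw [mem_ball_iff_norm] at hξ
    have hLP : ξ ∈ LPset 0 := by
      have := norm_sub_norm_le ξ (q - p)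
      change LPcond 0 ‖ξ‖
      simp only [LPcond, if_true]
      linarith
    rw [Set.indicator_of_mem hLP, fourier_Fnu (by linarith) hq hpq.ge ht.le,
      norm_sum_solutionHat t hpq.ge (by linarith), integral_sin_mul_cosCorr,
      Real.norm_of_nonneg (by positivity)]
    gcongr
    exact (integral_kernel_profile_ge ht ht' hp hq hpq hξ).trans (le_abs_self _)
  · rw [Set.indicator_of_notMem hξ, norm_zero]
    exact norm_nonneg _

/-- **Failure of the quadratic estimate for the second derivative of the gauge potential
flow.** For `s < 0` and `T > 0` there is no constant `C` with
`sup_{0≤t≤T} ‖(F₀,F₁,F₂)(t)‖_{H^s} ≤ C ‖ψ₀‖²_{H^s}` for all `ψ₀ ∈ H^s(ℝ²;ℂ²)`. -/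
theorem failure_quadratic_estimate_gauge_flow (s : ℝ) (hs : s < 0) (T : ℝ) (hT : 0 < T) :
    ¬ ∃ C : ℝ, ∀ ψ0 : Rd2 → Spinor, sobNorm s ψ0 ≠ ⊤ →
      ∀ t ∈ Set.Icc (0:ℝ) T,
        (∑ ν : Fin 3, sobNorm s (Fnu ψ0 ν t)) ≤ ENNReal.ofReal C * (sobNorm s ψ0)^2 := by
  rintro ⟨C, hC⟩
  let t : ℝ := min T (1 / 2)
  have ht : 0 < t := lt_min hT (by norm_num)
  let c : Rd2 := EuclideanSpace.single 0 1
  have hc : ‖c‖ = 1 := by simp [c]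
  let κ : ℝ := 8 * (t ^ 2 / 64 * volume.real (Metric.ball (0 : Rd2) (1 / 32)))
  let A : ℝ≥0∞ := eLpNorm ((Metric.ball c (1 / 32)).indicator fun _ => κ) 2 volume
  let M : ℝ≥0∞ := eLpNorm (spinorHat 0 c) 2 volume
  let ρ : ℝ≥0∞ := (2 : ℝ≥0∞) ^ (2 * s)
  have hM : M ≠ ⊤ := ((isTest_spinorHat 0 c).1.continuous.memLp_of_hasCompactSupport
    (isTest_spinorHat 0 c).2).eLpNorm_ne_top
  have hρ : ρ < 1 := ENNReal.rpow_lt_one_of_one_lt_of_neg (by norm_num) (by linarith)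
  have hκ : 0 < κ := by
    have : 0 < volume.real (Metric.ball (0 : Rd2) (1 / 32)) :=
      ENNReal.toReal_pos (Metric.measure_ball_pos _ _ (by norm_num)).ne' measure_ball_lt_top.ne
    positivity
  have hA : A ≠ 0 := by
    simp only [A]
    rw [eLpNorm_indicator_const measurableSet_ball (by norm_num) (by norm_num)]
    refine mul_ne_zero (by simpa using hκ.ne') ?_
    rw [Ne, ENNReal.rpow_eq_zero_iff]
    simp [Real.pi_pos]
  have hle : ∀ᶠ K : ℕ in Filter.atTop, A ≤ ENNReal.ofReal C * (ρ ^ K * M ^ 2) := by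
    have hlarge : ∀ᶠ K : ℕ in Filter.atTop, 2 + 64 / t ^ 2 ≤ (2 : ℝ) ^ K :=
      (tendsto_pow_atTop_atTop_of_one_lt (by norm_num)).eventually_ge_atTop _
    filter_upwards [hlarge, Filter.eventually_ge_atTop 2] with K hK hK2
    have h4 : (4 : ℝ) ≤ 2 ^ K := by
      calc (4 : ℝ) = 2 ^ 2 := by norm_num
        _ ≤ 2 ^ K := pow_le_pow_right₀ (by norm_num) hK2
    let p : Rd2 := EuclideanSpace.single 0 (3 / 2 * 2 ^ K)
    have hp : ‖p‖ = 3 / 2 * 2 ^ K := by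
      simp [p]
    have hpc : p + c - p = c := add_sub_cancel_left p c
    have hq : ‖p + c‖ ≤ ‖p‖ + 1 := hc ▸ norm_add_le p c
    have hq' : ‖p‖ - 1 ≤ ‖p + c‖ := by
      have := norm_sub_le (p + c) c
      rw [add_sub_cancel_right] at this
      linarith
    have hF : 𝓕 (𝓕⁻ (spinorHat p (p + c))) = spinorHat p (p + c) :=
      (isTest_spinorHat p (p + c)).fourier_fourierInv
    have hsob := sobNorm_sq s (K := K) (f := 𝓕⁻ (spinorHat p (p + c))) (by omega) fun ξ hξ => by
      rw [hF] at hξ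
      rw [pow_succ]
      rcases spinorHat_ne_zero hξ with h | h
      · have h1 := abs_le.1 ((abs_norm_sub_norm_le ξ p).trans h.le)
        constructor <;> linarith [h1.1, h1.2]
      · have h1 := abs_le.1 ((abs_norm_sub_norm_le ξ (p + c)).trans h.le)
        constructor <;> linarith [h1.1, h1.2]
    rw [hF, eLpNorm_spinorHat_add] at hsob
    have hfin : sobNorm s (𝓕⁻ (spinorHat p (p + c))) ≠ ⊤ := by
      intro htop
      rw [htop] at hsob
      refine (ENNReal.mul_lt_top ((ENNReal.pow_lt_top (hρ.trans ENNReal.one_lt_top)))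
        (ENNReal.pow_lt_top hM.lt_top)).ne (top_le_iff.1 (le_trans ?_ hsob))
      simp
    have h1 := le_LPnorm_zero_Fnu (p := p) (q := p + c) ht (min_le_right _ _) (by linarith)
      (by linarith : 1 ≤ ‖p + c‖) (by rw [hpc, hc])
    rw [hpc] at h1
    calc A ≤ sobNorm s (Fnu (𝓕⁻ (spinorHat p (p + c))) 0 t) :=
          h1.trans (LPnorm_zero_le_sobNorm s _)
      _ ≤ ∑ ν : Fin 3, sobNorm s (Fnu (𝓕⁻ (spinorHat p (p + c))) ν t) :=
          Finset.single_le_sum (f := fun ν => sobNorm s (Fnu (𝓕⁻ (spinorHat p (p + c))) ν t))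
            (fun _ _ => zero_le) (Finset.mem_univ 0)
      _ ≤ ENNReal.ofReal C * (sobNorm s (𝓕⁻ (spinorHat p (p + c)))) ^ 2 :=
          hC _ hfin t ⟨ht.le, min_le_left _ _⟩
      _ ≤ _ := by gcongr
  have hlim : Filter.Tendsto (fun K : ℕ => ENNReal.ofReal C * (ρ ^ K * M ^ 2)) Filter.atTop
      (nhds 0) := by
    have h1 := ENNReal.Tendsto.mul_const (b := M ^ 2)
      (ENNReal.tendsto_pow_atTop_nhds_zero_of_lt_one hρ) (.inr (ENNReal.pow_ne_top hM))
    simpa using ENNReal.Tendsto.const_mul h1 (.inr ENNReal.ofReal_ne_top)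
  exact hA (le_antisymm (ge_of_tendsto hlim hle) zero_le)

end
end
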